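/- arXiv:1310.6170 — 5 statements merged into one kernel-verified Lean document; each statement's English description precedes it below -/
import Mathlib

section
/- Let χ ∈ (−1,1), χ ≠ 0, and fix s > 0. For every integer r ≥ 0 and every real t ≥ 0, the r-th derivative of the function t ↦ L(t,s) satisfies | (d^r/dt^r) L(t,s) | ≤ r! · (t+s)^{r+1} / (t² + 2ts cos(χπ) + s²)^{r+1}. -/
open MeasureTheory

/-- The Mellin-type kernel `L(t,s)`. -/
noncomputable def Lker (χ t s : ℝ) : ℝ :=
  if t = 0 ∧ s = 0 then 0
  else -(s * Real.sin (χ * Real.pi)) / (s ^ 2 + 2 * t * s * Real.cos (χ * Real.pi) + t ^ 2)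

lemma Lker_aux_deriv (a : ℂ) (ha : a.im ≠ 0) (r : ℕ) (u : ℝ) :
    HasDerivAt (fun u : ℝ => ((-1 : ℂ) ^ r * (r.factorial : ℂ) * (((u : ℂ) + a) ^ (r + 1))⁻¹).im)
      (((-1 : ℂ) ^ (r + 1) * ((r + 1).factorial : ℂ) * (((u : ℂ) + a) ^ (r + 1 + 1))⁻¹).im) u := by
  have hne : (u : ℂ) + a ≠ 0 := by
    intro h
    apply ha
    have := congrArg Complex.im h
    simpa using this
  have h1 : HasDerivAt (fun u : ℝ => (u : ℂ) + a) 1 u :=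
    (Complex.ofRealCLM.hasDerivAt (x := u)).add_const a
  have h2 := ((h1.pow (r + 1)).inv (pow_ne_zero _ hne)).const_mul
    ((-1 : ℂ) ^ r * (r.factorial : ℂ))
  have h3 := Complex.imCLM.hasFDerivAt.comp_hasDerivAt u h2
  refine HasDerivAt.congr_deriv h3 ?_
  rw [Complex.imCLM_apply]
  congr 1
  simp only [Pi.pow_apply]
  rw [Nat.factorial_succ]
  push_cast
  field_simp
  try simp
  try ring

theorem Lker_iteratedDeriv_bound (χ : ℝ) (hχ : χ ∈ Set.Ioo (-1 : ℝ) 1) (hχ0 : χ ≠ 0)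
    (s : ℝ) (hs : 0 < s) (r : ℕ) (t : ℝ) (ht : 0 ≤ t) :
    |iteratedDeriv r (fun u => Lker χ u s) t| ≤
      (Nat.factorial r) * (t + s) ^ (r + 1) /
        (t ^ 2 + 2 * t * s * Real.cos (χ * Real.pi) + s ^ 2) ^ (r + 1) := by
  have hsin : Real.sin (χ * Real.pi) ≠ 0 := by
    intro h
    rw [Real.sin_eq_zero_iff_of_lt_of_lt] at h
    · exact hχ0 ((mul_eq_zero.mp h).resolve_right Real.pi_ne_zero)
    · nlinarith [hχ.1, Real.pi_pos]
    · nlinarith [hχ.2, Real.pi_pos]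
  have hsc := Real.sin_sq_add_cos_sq (χ * Real.pi)
  have hc1 := Real.cos_le_one (χ * Real.pi)
  set S := Real.sin (χ * Real.pi) with hS
  set C := Real.cos (χ * Real.pi) with hC
  obtain ⟨a, hare, haim⟩ : ∃ a : ℂ, a.re = s * C ∧ a.im = s * S := ⟨⟨s * C, s * S⟩, rfl, rfl⟩
  have ha : a.im ≠ 0 := by rw [haim]; exact mul_ne_zero hs.ne' hsin
  have hns : ∀ u : ℝ, Complex.normSq ((u : ℂ) + a) = u ^ 2 + 2 * u * s * C + s ^ 2 := by
    intro u
    simp only [Complex.normSq_apply, Complex.add_re, Complex.add_im, Complex.ofReal_re,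
      Complex.ofReal_im, hare, haim]
    linear_combination s ^ 2 * hsc
  have key : ∀ r : ℕ, iteratedDeriv r (fun u => Lker χ u s) =
      fun u : ℝ => ((-1 : ℂ) ^ r * (r.factorial : ℂ) * (((u : ℂ) + a) ^ (r + 1))⁻¹).im := by
    intro r
    induction r with
    | zero =>
      funext u
      simp only [iteratedDeriv_zero, Lker, hs.ne', and_false, if_false, pow_zero,
        Nat.factorial_zero, Nat.cast_one, one_mul, zero_add, pow_one, Complex.inv_im, hns]
      rw [Complex.add_im, Complex.ofReal_im, haim, ← hS, ← hC]
      congr 1 <;> ring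
    | succ r ih =>
      rw [iteratedDeriv_succ, ih]
      funext u
      exact (Lker_aux_deriv a ha r u).deriv
  rw [key r]
  have hD : ‖(t : ℂ) + a‖ ^ 2 = t ^ 2 + 2 * t * s * C + s ^ 2 := by
    rw [← hns, Complex.normSq_eq_norm_sq]
  have hpos : 0 < ‖(t : ℂ) + a‖ := by
    rw [norm_pos_iff]
    intro h
    apply ha
    simpa using congrArg Complex.im h
  have hle : ‖(t : ℂ) + a‖ ≤ t + s := by
    apply le_of_sq_le_sq _ (by positivity)
    rw [hD]
    nlinarith [mul_nonneg ht hs.le]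
  refine (Complex.abs_im_le_norm _).trans ?_
  rw [← hD]
  simp only [norm_mul, norm_pow, norm_neg, norm_one, one_pow, one_mul, norm_inv,
    Complex.norm_natCast]
  rw [mul_div_assoc]
  gcongr
  rw [← div_pow, ← inv_pow]
  gcongr
  rw [le_div_iff₀ (by positivity), pow_two, inv_mul_cancel_left₀ hpos.ne']
  exact hle
end

section
/- Let χ ∈ (−1,1), χ ≠ 0, and let r ≥ 1 be an integer. There exists a constant C > 0, depending only on χ and r, such that for every s ∈ (0,1]: ∫₀¹ | (d^r/dt^r) L(t,s) | · (t(1−t))^{r/2} dt ≤ C · r! / s^{r/2}, where the derivative is taken in the variable t. -/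
open MeasureTheory

theorem aux_iter (z : ℂ) (hz : z.im ≠ 0) (n : ℕ) :
    iteratedDeriv n (fun u : ℝ => (((u : ℂ) + z)⁻¹).im) =
      fun t : ℝ => (((-1 : ℂ) ^ n * (n.factorial : ℂ)) * (((t : ℂ) + z) ^ (n + 1))⁻¹).im := by
  induction n with
  | zero => ext t; simp
  | succ n ih =>
    rw [iteratedDeriv_succ, ih]
    ext t
    have hne : (t : ℂ) + z ≠ 0 := by
      intro h
      apply hz
      have := congrArg Complex.im h
      simpa using this
    have h1 : HasDerivAt (fun w : ℂ => (w + z)) 1 (t : ℂ) := (hasDerivAt_id _).add_const z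
    have h2 := (((h1.pow (n + 1)).inv (pow_ne_zero _ hne)).const_mul
      ((-1 : ℂ) ^ n * (n.factorial : ℂ))).comp_ofReal
    have h3 := (Complex.imCLM.hasFDerivAt.comp_hasDerivAt t h2).deriv
    refine Eq.trans h3 ?_
    rw [Complex.imCLM_apply]
    congr 1
    simp only [Pi.pow_apply, Nat.add_sub_cancel, Nat.factorial_succ]
    push_cast
    field_simp
    ring

theorem aux_lower (a b s t : ℝ) (hab : a ^ 2 + b ^ 2 = 1) (hs : 0 < s) (ht : 0 ≤ t) :
    Real.sqrt ((1 - |a|) / 2) * (t + s) ≤ ‖(t : ℂ) + ((s * a : ℝ) + (s * b : ℝ) * Complex.I)‖ := by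
  have ha : |a| ≤ 1 := by
    rw [abs_le]; constructor <;> nlinarith [sq_nonneg b]
  have h : ((t : ℂ) + ((s * a : ℝ) + (s * b : ℝ) * Complex.I)) =
      ((t + s * a : ℝ) + (s * b : ℝ) * Complex.I) := by push_cast; ring
  rw [h, Complex.norm_add_mul_I]
  apply Real.le_sqrt_of_sq_le
  rw [mul_pow, Real.sq_sqrt (by linarith)]
  have h1 : (t + s * a) ^ 2 + (s * b) ^ 2 = t ^ 2 + 2 * (t * s) * a + s ^ 2 := by
    linear_combination s ^ 2 * hab
  rw [h1]
  have h2 : -|a| ≤ a := neg_abs_le a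
  have h3 : 0 ≤ t * s := by positivity
  nlinarith [mul_nonneg h3 (by linarith : 0 ≤ a + |a|), sq_nonneg (t - s),
    mul_nonneg (by positivity : 0 ≤ 1 + |a|) (sq_nonneg (t - s))]

theorem aux_int (r : ℕ) (hr : 1 ≤ r) (s : ℝ) (hs : 0 < s) :
    IntervalIntegrable (fun t : ℝ => (t + s) ^ (-((r : ℝ) / 2) - 1)) volume 0 1 ∧
    ∫ t in (0:ℝ)..1, (t + s) ^ (-((r : ℝ) / 2) - 1) ≤ 2 * s ^ (-((r : ℝ) / 2)) := by
  have hr' : (1 : ℝ) ≤ r := by exact_mod_cast hr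
  constructor
  · apply ContinuousOn.intervalIntegrable
    intro t ht
    rw [Set.uIcc_of_le zero_le_one] at ht
    apply ContinuousAt.continuousWithinAt
    apply ContinuousAt.rpow_const (by fun_prop)
    left
    linarith [ht.1]
  · rw [intervalIntegral.integral_comp_add_right (fun x : ℝ => x ^ (-((r : ℝ) / 2) - 1)),
      integral_rpow]
    · have e : -((r : ℝ) / 2) - 1 + 1 = -((r : ℝ) / 2) := by ring
      rw [e, zero_add]
      have hA : 0 ≤ (1 + s) ^ (-((r : ℝ) / 2)) := by positivity
      have hB : 0 ≤ s ^ (-((r : ℝ) / 2)) := by positivity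
      rw [div_neg, ← neg_div, div_le_iff₀ (by linarith)]
      nlinarith
    · right
      constructor
      · intro h; linarith
      · rw [Set.uIcc_of_le (by linarith)]
        intro h
        linarith [h.1]

theorem Lker_iteratedDeriv_weighted_L1 (χ : ℝ) (hχ : χ ∈ Set.Ioo (-1 : ℝ) 1) (hχ0 : χ ≠ 0)
    (r : ℕ) (hr : 1 ≤ r) :
    ∃ C : ℝ, 0 < C ∧ ∀ s ∈ Set.Ioc (0:ℝ) 1,
      (∫ t in (0:ℝ)..1, |iteratedDeriv r (fun u => Lker χ u s) t| * (t * (1 - t)) ^ ((r : ℝ) / 2))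
        ≤ C * (Nat.factorial r) / s ^ ((r : ℝ) / 2) := by
  have hb : Real.sin (χ * Real.pi) ≠ 0 := by
    intro h
    rw [Real.sin_eq_zero_iff_of_lt_of_lt (by nlinarith [hχ.1, Real.pi_pos])
      (by nlinarith [hχ.2, Real.pi_pos])] at h
    rcases mul_eq_zero.1 h with h | h
    · exact hχ0 h
    · exact Real.pi_ne_zero h
  have hab : Real.cos (χ * Real.pi) ^ 2 + Real.sin (χ * Real.pi) ^ 2 = 1 :=
    Real.cos_sq_add_sin_sq _
  have hL : ∀ s : ℝ, 0 < s → (fun u => Lker χ u s) = fun u : ℝ => (((u : ℂ) +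
      ((s * Real.cos (χ * Real.pi) : ℝ) + (s * Real.sin (χ * Real.pi) : ℝ) * Complex.I))⁻¹).im := by
    intro s hs
    ext u
    have : ¬ (u = 0 ∧ s = 0) := fun h => hs.ne' h.2
    rw [Lker, if_neg this, Complex.inv_im, Complex.normSq_apply]
    simp only [Complex.add_im, Complex.add_re, Complex.ofReal_re, Complex.ofReal_im,
      Complex.mul_re, Complex.mul_im, Complex.I_re, Complex.I_im]
    congr 1
    · ring
    · linear_combination (-s ^ 2) * hab
  generalize Real.cos (χ * Real.pi) = a at *
  generalize Real.sin (χ * Real.pi) = b at *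
  have ha : |a| < 1 := by
    have : 0 < b ^ 2 := by positivity
    rw [abs_lt]; constructor <;> nlinarith
  obtain ⟨k, hk⟩ : ∃ k, k = Real.sqrt ((1 - |a|) / 2) := ⟨_, rfl⟩
  have hkpos : 0 < k := by rw [hk]; apply Real.sqrt_pos.2; linarith
  refine ⟨2 * (k ^ (r + 1))⁻¹, by positivity, ?_⟩
  rintro s ⟨hs, -⟩
  rw [hL s hs, aux_iter _ (by simp [hs.ne', hb])]
  obtain ⟨hi, hle⟩ := aux_int r hr s hs
  have hr0 : (0 : ℝ) ≤ (r : ℝ) / 2 := by positivity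
  refine (le_abs_self _).trans ?_
  rw [← Real.norm_eq_abs]
  refine (intervalIntegral.norm_integral_le_of_norm_le zero_le_one (Filter.Eventually.of_forall ?_)
    (hi.const_mul ((k ^ (r + 1))⁻¹ * r.factorial))).trans ?_
  · rintro t ⟨ht0, ht1⟩
    have hlow := aux_lower a b s t hab hs ht0.le
    rw [← hk] at hlow
    have hts : 0 < t + s := by linarith
    have h1t : 0 ≤ t * (1 - t) := mul_nonneg ht0.le (by linarith)
    have hw : (t * (1 - t)) ^ ((r : ℝ) / 2) ≤ (t + s) ^ ((r : ℝ) / 2) :=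
      Real.rpow_le_rpow h1t (by nlinarith) hr0
    rw [norm_mul, Real.norm_eq_abs, abs_abs, Real.norm_of_nonneg (Real.rpow_nonneg h1t _)]
    refine (mul_le_mul ((Complex.abs_im_le_norm _).trans ?_) hw (Real.rpow_nonneg h1t _)
      (b := (r.factorial : ℝ) * ((k * (t + s)) ^ (r + 1))⁻¹) (by positivity)).trans ?_
    · rw [norm_mul, norm_mul, norm_pow, norm_neg, norm_one, one_pow, one_mul, norm_inv, norm_pow,
        Complex.norm_natCast]
      gcongr
    · apply le_of_eq
      have e : (t + s) ^ (-((r : ℝ) / 2) - 1) =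
          (t + s) ^ ((r : ℝ) / 2) * ((t + s) ^ (r + 1))⁻¹ := by
        rw [← Real.rpow_natCast, ← Real.rpow_neg hts.le, ← Real.rpow_add hts]
        congr 1
        push_cast
        ring
      rw [e, mul_pow, mul_inv]
      ring
  · rw [intervalIntegral.integral_const_mul]
    refine (mul_le_mul_of_nonneg_left hle (by positivity)).trans (le_of_eq ?_)
    rw [Real.rpow_neg hs.le]
    ring
end

section
/- Let χ ∈ (−1,1), χ ≠ 0, and let r ≥ 1 be an integer. The function x ↦ (x+1)^{r+1} · x^{r/2} / (x² + 2x cos(χπ) + 1)^{r+1} is integrable on (0, ∞); moreover, for every s > 0, ∫₀¹ (t+s)^{r+1} · t^{r/2} / (t² + 2ts cos(χπ) + s²)^{r+1} dt ≤ s^{−r/2} · ∫₀^∞ (x+1)^{r+1} · x^{r/2} / (x² + 2x cos(χπ) + 1)^{r+1} dx. -/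
open MeasureTheory

theorem kernel_integrand_substitution (χ : ℝ) (hχ : χ ∈ Set.Ioo (-1 : ℝ) 1) (hχ0 : χ ≠ 0)
    (r : ℕ) (hr : 1 ≤ r) :
    IntegrableOn
      (fun x : ℝ => (x + 1) ^ (r + 1) * x ^ ((r : ℝ) / 2) /
        (x ^ 2 + 2 * x * Real.cos (χ * Real.pi) + 1) ^ (r + 1)) (Set.Ioi 0) ∧
    ∀ s : ℝ, 0 < s →
      (∫ t in (0:ℝ)..1, (t + s) ^ (r + 1) * t ^ ((r : ℝ) / 2) /
          (t ^ 2 + 2 * t * s * Real.cos (χ * Real.pi) + s ^ 2) ^ (r + 1)) ≤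
        s ^ (-(r : ℝ) / 2) *
          ∫ x in Set.Ioi (0:ℝ), (x + 1) ^ (r + 1) * x ^ ((r : ℝ) / 2) /
            (x ^ 2 + 2 * x * Real.cos (χ * Real.pi) + 1) ^ (r + 1) := by
  have hc : -1 < Real.cos (χ * Real.pi) := by
    have hπ := Real.pi_pos
    have h1 : |χ * Real.pi| < Real.pi := by
      rw [abs_mul, abs_of_pos hπ]
      have := abs_lt.mpr hχ
      nlinarith
    rw [← Real.cos_abs, ← Real.cos_pi]
    exact Real.cos_lt_cos_of_nonneg_of_le_pi (abs_nonneg _) le_rfl h1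
  have hc1 : Real.cos (χ * Real.pi) ≤ 1 := Real.cos_le_one _
  generalize Real.cos (χ * Real.pi) = c at hc hc1 ⊢
  have hr' : (1 : ℝ) ≤ r := by exact_mod_cast hr
  have hden : ∀ x : ℝ, 0 < x → (1 + c) / 2 * (x + 1) ^ 2 ≤ x ^ 2 + 2 * x * c + 1 := by
    intro x hx
    nlinarith [mul_nonneg (sub_nonneg.mpr hc1) (sq_nonneg (x - 1))]
  have hδ : 0 < (1 + c) / 2 := by linarith
  have hpos : ∀ x : ℝ, 0 < x → 0 < x ^ 2 + 2 * x * c + 1 := fun x hx =>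
    lt_of_lt_of_le (by positivity) (hden x hx)
  set f : ℝ → ℝ := fun x : ℝ => (x + 1) ^ (r + 1) * x ^ ((r : ℝ) / 2) /
        (x ^ 2 + 2 * x * c + 1) ^ (r + 1) with hf
  have hf0 : ∀ x : ℝ, 0 < x → 0 ≤ f x := by
    intro x hx
    have := hpos x hx
    simp only [hf]
    positivity
  have hint : IntegrableOn f (Set.Ioi 0) := by
    have hg : IntegrableOn (fun x : ℝ => (((1 + c) / 2) ^ (r + 1))⁻¹ *
        (x + 1) ^ (-((r : ℝ) / 2) - 1)) (Set.Ioi 0) :=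
      (integrableOn_add_rpow_Ioi_of_lt (by linarith) (by norm_num)).const_mul _
    refine Integrable.mono' hg ?_ ?_
    · apply Measurable.aestronglyMeasurable
      simp only [hf]
      fun_prop
    · refine (ae_restrict_iff' measurableSet_Ioi).mpr (Filter.Eventually.of_forall ?_)
      intro x (hx : 0 < x)
      rw [Real.norm_of_nonneg (hf0 x hx)]
      have hx1 : 0 < x + 1 := by linarith
      have e : (x + 1) ^ (-((r : ℝ) / 2) - 1) =
          (x + 1) ^ ((r : ℝ) / 2) / (x + 1) ^ (r + 1) := by
        rw [← Real.rpow_natCast (x + 1) (r + 1), ← Real.rpow_sub hx1]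
        congr 1
        push_cast
        ring
      rw [e]
      calc f x ≤ (x + 1) ^ (r + 1) * (x + 1) ^ ((r : ℝ) / 2) /
            ((1 + c) / 2 * (x + 1) ^ 2) ^ (r + 1) := by
            simp only [hf]
            have h1 := hden x hx
            have h2 : x ≤ x + 1 := by linarith
            gcongr
        _ = _ := by
            rw [mul_pow]
            field_simp
            rw [← pow_mul, ← pow_mul, mul_comm]
  refine ⟨hint, fun s hs => ?_⟩
  have key : ∀ t : ℝ, 0 < t → (t + s) ^ (r + 1) * t ^ ((r : ℝ) / 2) /
          (t ^ 2 + 2 * t * s * c + s ^ 2) ^ (r + 1) =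
      s ^ (-(r : ℝ) / 2) * s⁻¹ * f (s⁻¹ * t) := by
    intro t ht
    obtain ⟨x, rfl⟩ : ∃ x, t = s * x := ⟨s⁻¹ * t, by field_simp⟩
    have hx : 0 < x := pos_of_mul_pos_right ht hs.le
    have hp := hpos x hx
    have e1 : s⁻¹ * (s * x) = x := by field_simp
    rw [e1]
    simp only [hf]
    have e2 : (s * x) ^ 2 + 2 * (s * x) * s * c + s ^ 2 = s ^ 2 * (x ^ 2 + 2 * x * c + 1) := by
      ring
    have e3 : s * x + s = s * (x + 1) := by ring
    have e4 : s ^ (-(r : ℝ) / 2) = s ^ ((r : ℝ) / 2) / s ^ r := by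
      rw [← Real.rpow_natCast s r, ← Real.rpow_sub hs]
      congr 1
      ring
    rw [e2, e3, e4, Real.mul_rpow hs.le hx.le, mul_pow, mul_pow]
    field_simp
    try ring
  have hint2 : IntegrableOn (fun t => s ^ (-(r : ℝ) / 2) * s⁻¹ * f (s⁻¹ * t)) (Set.Ioi 0) := by
    refine Integrable.const_mul ?_ _
    have := (integrableOn_Ioi_comp_mul_left_iff f 0 (inv_pos.mpr hs)).mpr (by simpa using hint)
    exact this
  rw [intervalIntegral.integral_of_le zero_le_one]
  calc _ = ∫ t in Set.Ioc (0:ℝ) 1, s ^ (-(r : ℝ) / 2) * s⁻¹ * f (s⁻¹ * t) :=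
        setIntegral_congr_fun measurableSet_Ioc fun t ht => key t ht.1
    _ ≤ ∫ t in Set.Ioi (0:ℝ), s ^ (-(r : ℝ) / 2) * s⁻¹ * f (s⁻¹ * t) := by
        refine setIntegral_mono_set hint2 ?_ ?_
        · refine (ae_restrict_iff' measurableSet_Ioi).mpr (Filter.Eventually.of_forall ?_)
          intro t (ht : 0 < t)
          have := hf0 (s⁻¹ * t) (by positivity)
          show 0 ≤ s ^ (-(r : ℝ) / 2) * s⁻¹ * f (s⁻¹ * t)
          positivity
        · exact (Set.Ioc_subset_Ioi_self).eventuallyLE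
    _ = _ := by
        rw [integral_const_mul, integral_comp_mul_left_Ioi f 0 (inv_pos.mpr hs)]
        simp only [mul_zero, inv_inv, smul_eq_mul]
        field_simp
end

section
/- Let χ ∈ (−1,1), χ ≠ 0, and let ρ : [0,1] → ℝ be continuous. Then lim_{s → 0⁺} ∫₀¹ L(t,s) ρ(t) dt = −χπ · ρ(0). -/
open MeasureTheory Filter

lemma den_pos_aux {a : ℝ} (h : Real.sin a ≠ 0) (u : ℝ) :
    0 < 1 + 2 * u * Real.cos a + u ^ 2 := by
  have h1 := Real.sin_sq_add_cos_sq a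
  have h2 : 0 < Real.sin a ^ 2 := by positivity
  nlinarith [sq_nonneg (u + Real.cos a)]

lemma ker_pos_aux {a : ℝ} (h0 : 0 < a) (h1 : a < Real.pi) :
    IntegrableOn (fun u => Real.sin a / (1 + 2 * u * Real.cos a + u ^ 2)) (Set.Ioi 0) ∧
    ∫ u in Set.Ioi (0:ℝ), Real.sin a / (1 + 2 * u * Real.cos a + u ^ 2) = a := by
  have hs : 0 < Real.sin a := Real.sin_pos_of_pos_of_lt_pi h0 h1
  have hd : ∀ x : ℝ, HasDerivAt (fun u => Real.arctan ((u + Real.cos a) / Real.sin a))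
      (Real.sin a / (1 + 2 * x * Real.cos a + x ^ 2)) x := by
    intro x
    have := (((hasDerivAt_id x).add_const (Real.cos a)).div_const (Real.sin a)).arctan
    refine this.congr_deriv ?_
    have hp := den_pos_aux hs.ne' x
    have h2 := Real.sin_sq_add_cos_sq a
    have h3 : 1 + ((id x + Real.cos a) / Real.sin a) ^ 2
        = (1 + 2 * x * Real.cos a + x ^ 2) / Real.sin a ^ 2 := by
      simp only [id]
      field_simp
      linear_combination h2
    rw [h3]
    field_simp
  have hlim : Tendsto (fun u => Real.arctan ((u + Real.cos a) / Real.sin a)) atTop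
      (nhds (Real.pi / 2)) := by
    have h4 : Tendsto Real.arctan atTop (nhds (Real.pi / 2)) :=
      Real.tendsto_arctan_atTop.mono_right nhdsWithin_le_nhds
    refine h4.comp ?_
    exact (tendsto_atTop_add_const_right _ _ tendsto_id).atTop_div_const hs
  have hint : IntegrableOn (fun u => Real.sin a / (1 + 2 * u * Real.cos a + u ^ 2))
      (Set.Ioi 0) :=
    integrableOn_Ioi_deriv_of_nonneg' (fun x _ => hd x)
      (fun x _ => div_nonneg hs.le (den_pos_aux hs.ne' x).le) hlim
  refine ⟨hint, ?_⟩
  rw [integral_Ioi_of_hasDerivAt_of_tendsto' (fun x _ => hd x) hint hlim]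
  have : (0 + Real.cos a) / Real.sin a = Real.tan (Real.pi / 2 - a) := by
    rw [Real.tan_pi_div_two_sub, Real.tan_eq_sin_div_cos, inv_div, zero_add]
  rw [this, Real.arctan_tan (by linarith) (by linarith)]
  ring

lemma ker_aux {a : ℝ} (h0 : a ≠ 0) (h1 : a < Real.pi) (h2 : -Real.pi < a) :
    IntegrableOn (fun u => Real.sin a / (1 + 2 * u * Real.cos a + u ^ 2)) (Set.Ioi 0) ∧
    ∫ u in Set.Ioi (0:ℝ), Real.sin a / (1 + 2 * u * Real.cos a + u ^ 2) = a := by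
  rcases lt_or_gt_of_ne h0 with h | h
  · obtain ⟨ha, hb⟩ := ker_pos_aux (a := -a) (by linarith) (by linarith)
    simp only [Real.sin_neg, Real.cos_neg, neg_div] at ha hb
    rw [integral_neg] at hb
    refine ⟨?_, by linarith⟩
    simpa using ha.neg
  · exact ker_pos_aux h h1

theorem Lker_integral_limit (χ : ℝ) (hχ : χ ∈ Set.Ioo (-1 : ℝ) 1) (hχ0 : χ ≠ 0)
    (ρ : ℝ → ℝ) (hρ : ContinuousOn ρ (Set.Icc 0 1)) :
    Tendsto (fun s => ∫ t in (0:ℝ)..1, Lker χ t s * ρ t)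
      (nhdsWithin 0 (Set.Ioi 0)) (nhds (-(χ * Real.pi) * ρ 0)) := by
  have hpi := Real.pi_pos
  have ha0 : χ * Real.pi ≠ 0 := mul_ne_zero hχ0 hpi.ne'
  have ha1 : χ * Real.pi < Real.pi := by nlinarith [hχ.2]
  have ha2 : -Real.pi < χ * Real.pi := by nlinarith [hχ.1]
  have hsin : Real.sin (χ * Real.pi) ≠ 0 := by
    intro h
    exact ha0 ((Real.sin_eq_zero_iff_of_lt_of_lt ha2 ha1).1 h)
  obtain ⟨hint, hval⟩ := ker_aux ha0 ha1 ha2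
  have hden := den_pos_aux hsin
  have hL : ∀ s > 0, ∀ u, s * Lker χ (s * u) s = -(Real.sin (χ * Real.pi) /
      (1 + 2 * u * Real.cos (χ * Real.pi) + u ^ 2)) := by
    intro s hs u
    have h1 := hden u
    rw [Lker, if_neg (fun h => hs.ne' h.2)]
    have : s ^ 2 + 2 * (s * u) * s * Real.cos (χ * Real.pi) + (s * u) ^ 2
      = s ^ 2 * (1 + 2 * u * Real.cos (χ * Real.pi) + u ^ 2) := by ring
    rw [this]
    field_simp
  set k : ℝ → ℝ := fun u => Real.sin (χ * Real.pi) /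
      (1 + 2 * u * Real.cos (χ * Real.pi) + u ^ 2) with hk
  have hkc : Continuous k := by
    refine Continuous.div (by fun_prop) (by fun_prop) (fun u => (hden u).ne')
  obtain ⟨M, hM⟩ := isCompact_Icc.exists_bound_of_continuousOn hρ
  set g : ℝ → ℝ := Set.IccExtend (zero_le_one' ℝ) ((Set.Icc (0:ℝ) 1).domRestrict ρ) with hg
  have hgc : Continuous g := (continuousOn_iff_continuous_domRestrict.1 hρ).Icc_extend'
  have hgρ : ∀ t ∈ Set.Icc (0:ℝ) 1, g t = ρ t := fun t ht => by
    rw [hg, Set.IccExtend_of_mem _ _ ht]; rfl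
  have hgM : ∀ t, ‖g t‖ ≤ M := fun t => hM _ (Set.projIcc 0 1 (zero_le_one' ℝ) t).2
  have key : ∀ s > 0, ∫ t in (0:ℝ)..1, Lker χ t s * ρ t
      = ∫ u in Set.Ioi (0:ℝ), (Set.Ioc 0 s⁻¹).indicator (fun u => -k u * g (s * u)) u := by
    intro s hs
    have h1 : ∫ t in (0:ℝ)..1, Lker χ t s * ρ t = ∫ t in (0:ℝ)..1, Lker χ t s * g t := by
      apply intervalIntegral.integral_congr
      intro t ht
      rw [Set.uIcc_of_le zero_le_one] at ht
      simp only [hgρ t ht]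
    have h2 := intervalIntegral.mul_integral_comp_mul_left (a := 0) (b := s⁻¹)
      (f := fun t => Lker χ t s * g t) s
    rw [mul_zero, mul_inv_cancel₀ hs.ne'] at h2
    rw [h1, ← h2, ← intervalIntegral.integral_const_mul,
      intervalIntegral.integral_of_le (by positivity),
      setIntegral_indicator measurableSet_Ioc]
    have h3 : Set.Ioi (0:ℝ) ∩ Set.Ioc 0 s⁻¹ = Set.Ioc 0 s⁻¹ :=
      Set.inter_eq_right.2 (fun x hx => hx.1)
    rw [h3]
    refine integral_congr_ae (Eventually.of_forall fun u => ?_)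
    simp only [← mul_assoc, hL s hs u, hk]
  have hmain : Tendsto (fun s : ℝ => ∫ u in Set.Ioi (0:ℝ),
      (Set.Ioc 0 s⁻¹).indicator (fun u => -k u * g (s * u)) u)
      (nhdsWithin 0 (Set.Ioi 0)) (nhds (∫ u in Set.Ioi (0:ℝ), -k u * ρ 0)) := by
    refine tendsto_integral_filter_of_dominated_convergence (fun u => ‖k u‖ * M) ?_ ?_ ?_ ?_
    · refine Eventually.of_forall fun s => ?_
      refine (Continuous.aestronglyMeasurable ?_).indicator measurableSet_Ioc
      fun_prop
    · refine Eventually.of_forall fun s => Eventually.of_forall fun u => ?_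
      refine (norm_indicator_le_norm_self _ _).trans ?_
      rw [norm_mul, norm_neg]
      exact mul_le_mul_of_nonneg_left (hgM _) (norm_nonneg _)
    · exact hint.norm.mul_const M
    · refine (ae_restrict_iff' measurableSet_Ioi).2 (Eventually.of_forall fun u hu => ?_)
      have h0 : g 0 = ρ 0 := hgρ 0 (by simp)
      have h5 : Tendsto (fun s : ℝ => -k u * g (s * u)) (nhdsWithin 0 (Set.Ioi 0))
          (nhds (-k u * ρ 0)) := by
        have : Continuous (fun s : ℝ => -k u * g (s * u)) := by fun_prop
        have h6 := this.tendsto 0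
        rw [zero_mul, h0] at h6
        exact h6.mono_left nhdsWithin_le_nhds
      refine h5.congr' ?_
      filter_upwards [tendsto_inv_nhdsGT_zero.eventually (eventually_ge_atTop u)] with s hs
      rw [Set.indicator_of_mem (show u ∈ Set.Ioc 0 s⁻¹ from ⟨hu, hs⟩)]
  have hfin : ∫ u in Set.Ioi (0:ℝ), -k u * ρ 0 = -(χ * Real.pi) * ρ 0 := by
    rw [integral_mul_const, integral_neg, hval]
  rw [hfin] at hmain
  refine hmain.congr' ?_
  filter_upwards [self_mem_nhdsWithin] with s hs
  exact (key s hs).symm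
end

section
/- Let χ ∈ (−1,1), χ ≠ 0, and let ρ₁, ρ₂ : [0,1] → ℝ be continuous functions with ρ₁(0) = ρ₂(0). Define g : [0,1] → ℝ by g(s) = ∫₀¹ L(t,s) ρ₂(t) dt for s ∈ (0,1] and g(0) = −χπ · ρ₁(0). Then g is continuous on [0,1] and sup_{s ∈ [0,1]} |g(s)| ≤ |χ|·π · max(‖ρ₁‖_∞, ‖ρ₂‖_∞). -/
open MeasureTheory

namespace WedgeAux
open Set Filter Topology

noncomputable def ker (a u : ℝ) : ℝ := Real.sin a / (1 + 2 * u * Real.cos a + u ^ 2)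

lemma den_eq (a u : ℝ) :
    1 + 2 * u * Real.cos a + u ^ 2 = (u + Real.cos a) ^ 2 + Real.sin a ^ 2 := by
  have := Real.sin_sq_add_cos_sq a
  nlinarith

lemma den_pos {a : ℝ} (ha : 0 < Real.sin a) (u : ℝ) :
    0 < 1 + 2 * u * Real.cos a + u ^ 2 := by
  rw [den_eq]; positivity

lemma ker_nonneg {a : ℝ} (ha : 0 < Real.sin a) (u : ℝ) : 0 ≤ ker a u :=
  div_nonneg ha.le (den_pos ha u).le

lemma ker_cont {a : ℝ} (ha : 0 < Real.sin a) : Continuous (ker a) := by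
  unfold ker
  exact continuous_const.div (by fun_prop) (fun u => (den_pos ha u).ne')

lemma ker_deriv {a : ℝ} (ha : 0 < Real.sin a) (u : ℝ) :
    HasDerivAt (fun u => Real.arctan ((u + Real.cos a) / Real.sin a)) (ker a u) u := by
  have h := (((hasDerivAt_id u).add_const (Real.cos a)).div_const (Real.sin a)).arctan
  refine HasDerivAt.congr_deriv h ?_
  unfold ker
  rw [den_eq]
  have h1 : 0 < (u + Real.cos a) ^ 2 + Real.sin a ^ 2 := by positivity
  have h2 : 0 < Real.sin a ^ 2 + (u + Real.cos a) ^ 2 := by positivity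
  simp only [id]
  field_simp
  ring

lemma ker_tendsto {a : ℝ} (ha : 0 < Real.sin a) :
    Tendsto (fun u => Real.arctan ((u + Real.cos a) / Real.sin a)) atTop (𝓝 (Real.pi / 2)) := by
  have h := Real.tendsto_arctan_atTop.mono_right nhdsWithin_le_nhds
  exact h.comp ((tendsto_atTop_add_const_right _ _ tendsto_id).atTop_div_const ha)

lemma arctan_cot {a : ℝ} (h0 : 0 < a) (h1 : a < Real.pi) :
    Real.arctan ((0 + Real.cos a) / Real.sin a) = Real.pi / 2 - a := by
  have h : (0 + Real.cos a) / Real.sin a = Real.tan (Real.pi / 2 - a) := by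
    rw [Real.tan_eq_sin_div_cos, Real.sin_pi_div_two_sub, Real.cos_pi_div_two_sub, zero_add]
  rw [h]
  exact Real.arctan_tan (by linarith) (by linarith)

lemma ker_int {a : ℝ} (ha : 0 < Real.sin a) : IntegrableOn (ker a) (Ioi 0) :=
  integrableOn_Ioi_deriv_of_nonneg (ker_deriv ha 0).continuousAt.continuousWithinAt
    (fun u _ => ker_deriv ha u) (fun u _ => ker_nonneg ha u) (ker_tendsto ha)

lemma ker_integral {a : ℝ} (h0 : 0 < a) (h1 : a < Real.pi) : ∫ u in Ioi 0, ker a u = a := by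
  have ha := Real.sin_pos_of_pos_of_lt_pi h0 h1
  rw [integral_Ioi_of_hasDerivAt_of_nonneg (ker_deriv ha 0).continuousAt.continuousWithinAt
    (fun u _ => ker_deriv ha u) (fun u _ => ker_nonneg ha u) (ker_tendsto ha), arctan_cot h0 h1]
  ring

open Classical in
noncomputable def ext (ρ : ℝ → ℝ) : ℝ → ℝ := (Icc (0:ℝ) 1).piecewise ρ (fun _ => 0)

lemma ext_meas {ρ : ℝ → ℝ} (h : ContinuousOn ρ (Icc 0 1)) : Measurable (ext ρ) := by
  classical
  unfold ext
  exact ContinuousOn.measurable_piecewise h continuousOn_const measurableSet_Icc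

lemma ext_of_mem {ρ : ℝ → ℝ} {x : ℝ} (h : x ∈ Icc (0:ℝ) 1) : ext ρ x = ρ x := by
  simp only [ext]; exact piecewise_eq_of_mem _ _ _ h

lemma ext_of_notMem {ρ : ℝ → ℝ} {x : ℝ} (h : x ∉ Icc (0:ℝ) 1) : ext ρ x = 0 := by
  simp only [ext]; exact piecewise_eq_of_notMem _ _ _ h

lemma ext_bound {ρ : ℝ → ℝ} {M : ℝ} (hM : ∀ t ∈ Icc (0:ℝ) 1, |ρ t| ≤ M) (x : ℝ) :
    |ext ρ x| ≤ M := by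
  by_cases h : x ∈ Icc (0:ℝ) 1
  · rw [ext_of_mem h]; exact hM x h
  · rw [ext_of_notMem h, abs_zero]
    exact (abs_nonneg _).trans (hM 0 (by simp))

lemma ext_cont {ρ : ℝ → ℝ} (h : ContinuousOn ρ (Icc 0 1)) {x : ℝ} (hx : 0 ≤ x) (hx1 : x ≠ 1) :
    ContinuousWithinAt (ext ρ) (Ici 0) x := by
  rcases lt_or_gt_of_ne hx1 with h1 | h1
  · have : ContinuousWithinAt (ext ρ) (Icc 0 1) x :=
      (h x ⟨hx, h1.le⟩).congr (fun y hy => ext_of_mem hy) (ext_of_mem ⟨hx, h1.le⟩)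
    refine this.mono_of_mem_nhdsWithin ?_
    filter_upwards [self_mem_nhdsWithin, mem_nhdsWithin_of_mem_nhds (Iio_mem_nhds h1)] with y h2 h3
    exact ⟨h2, le_of_lt h3⟩
  · refine ContinuousAt.continuousWithinAt ?_
    refine (continuousAt_const (y := (0:ℝ))).congr ?_
    filter_upwards [Ioi_mem_nhds h1] with y hy
    exact (ext_of_notMem (fun h => absurd h.2 (not_le.mpr hy))).symm

noncomputable def G (a : ℝ) (ρ : ℝ → ℝ) (s : ℝ) : ℝ := ∫ u in Ioi 0, ker a u * ext ρ (s * u)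

lemma exists_bound {ρ : ℝ → ℝ} (h : ContinuousOn ρ (Icc 0 1)) :
    ∃ M, ∀ t ∈ Icc (0:ℝ) 1, |ρ t| ≤ M := isCompact_Icc.exists_bound_of_continuousOn h

lemma G_bound {a : ℝ} (h0 : 0 < a) (h1 : a < Real.pi) {ρ : ℝ → ℝ} {M : ℝ}
    (hM : ∀ t ∈ Icc (0:ℝ) 1, |ρ t| ≤ M) (s : ℝ) : |G a ρ s| ≤ a * M := by
  have ha := Real.sin_pos_of_pos_of_lt_pi h0 h1
  have : ‖G a ρ s‖ ≤ ∫ u in Ioi 0, ker a u * M := by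
    refine norm_integral_le_of_norm_le ((ker_int ha).mul_const M) (ae_of_all _ fun u => ?_)
    rw [norm_mul, Real.norm_eq_abs, Real.norm_eq_abs, abs_of_nonneg (ker_nonneg ha u)]
    exact mul_le_mul_of_nonneg_left (ext_bound hM _) (ker_nonneg ha u)
  rwa [integral_mul_const, ker_integral h0 h1] at this

lemma G_cont {a : ℝ} (h0 : 0 < a) (h1 : a < Real.pi) {ρ : ℝ → ℝ}
    (h : ContinuousOn ρ (Icc 0 1)) : ContinuousOn (G a ρ) (Icc 0 1) := by
  have ha := Real.sin_pos_of_pos_of_lt_pi h0 h1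
  obtain ⟨M, hM⟩ := exists_bound h
  intro s hs
  refine continuousWithinAt_of_dominated (bound := fun u => ker a u * M) ?_ ?_
    ((ker_int ha).mul_const M) ?_
  · refine Eventually.of_forall fun x => Measurable.aestronglyMeasurable ?_
    exact (ker_cont ha).measurable.mul ((ext_meas h).comp (measurable_const_mul x))
  · refine Eventually.of_forall fun x => ae_of_all _ fun u => ?_
    rw [norm_mul, Real.norm_eq_abs, Real.norm_eq_abs, abs_of_nonneg (ker_nonneg ha u)]
    exact mul_le_mul_of_nonneg_left (ext_bound hM _) (ker_nonneg ha u)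
  · have hne : ∀ᵐ u ∂(volume.restrict (Ioi (0:ℝ))), u ≠ s⁻¹ :=
      ae_restrict_of_ae (Measure.ae_ne volume _)
    filter_upwards [hne, ae_restrict_mem measurableSet_Ioi] with u hu hu0
    have hu0' : 0 < u := hu0
    have hsu : s * u ≠ 1 := fun hh => hu (eq_inv_of_mul_eq_one_right hh)
    have hc := ext_cont h (mul_nonneg hs.1 hu0'.le) hsu
    refine continuousWithinAt_const.mul ?_
    exact ContinuousWithinAt.comp (f := fun x => x * u) (g := ext ρ) hc
      (by fun_prop) (fun x hx => mul_nonneg hx.1 hu0'.le)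

lemma G_zero {a : ℝ} (h0 : 0 < a) (h1 : a < Real.pi) (ρ : ℝ → ℝ) : G a ρ 0 = a * ρ 0 := by
  simp only [G, zero_mul]
  rw [integral_mul_const, ker_integral h0 h1, ext_of_mem (by simp)]

lemma G_pos (χ : ℝ) (ρ : ℝ → ℝ) {s : ℝ} (hs : 0 < s) :
    ∫ t in (0:ℝ)..1, Lker χ t s * ρ t = - G (χ * Real.pi) ρ s := by
  have e1 : ∫ t in (0:ℝ)..1, Lker χ t s * ρ t = ∫ t in Ioi 0, Lker χ t s * ext ρ t := by
    rw [intervalIntegral.integral_of_le zero_le_one]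
    have : Ioc (0:ℝ) 1 ⊆ Ioi 0 := fun x hx => hx.1
    rw [setIntegral_eq_of_subset_of_forall_sdiff_eq_zero (s := Ioc (0:ℝ) 1) measurableSet_Ioi this]
    · refine setIntegral_congr_fun measurableSet_Ioc fun t ht => ?_
      simp only [ext_of_mem (ρ := ρ) (Ioc_subset_Icc_self ht)]
    · intro t ht
      rw [ext_of_notMem, mul_zero]
      exact fun h => ht.2 ⟨ht.1, h.2⟩
  have e2 := integral_comp_mul_left_Ioi (fun t => Lker χ t s * ext ρ t) 0 hs
  rw [mul_zero, smul_eq_mul] at e2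
  rw [e1, G, ← integral_neg]
  have e3 : ∫ t in Ioi 0, Lker χ t s * ext ρ t
      = s * ∫ x in Ioi 0, Lker χ (s * x) s * ext ρ (s * x) := by
    rw [e2]; field_simp
  rw [e3, ← integral_const_mul]
  congr 1
  funext u
  have : s * Lker χ (s * u) s = - ker (χ * Real.pi) u := by
    unfold Lker ker
    rw [if_neg (fun h => hs.ne' h.2)]
    have : s ^ 2 + 2 * (s * u) * s * Real.cos (χ * Real.pi) + (s * u) ^ 2
      = s ^ 2 * (1 + 2 * u * Real.cos (χ * Real.pi) + u ^ 2) := by ring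
    rw [this, ← div_div, mul_div_assoc', ← neg_div]
    congr 1
    field_simp
  rw [← mul_assoc, this]; ring

lemma Lker_neg (χ t s : ℝ) : Lker (-χ) t s = - Lker χ t s := by
  unfold Lker
  split_ifs
  · simp
  · rw [neg_mul, Real.sin_neg, Real.cos_neg]; ring

lemma le_biSup {ρ : ℝ → ℝ} (h : ContinuousOn ρ (Icc 0 1)) {t : ℝ} (ht : t ∈ Icc (0:ℝ) 1) :
    |ρ t| ≤ ⨆ t ∈ Icc (0:ℝ) 1, |ρ t| := by
  obtain ⟨M, hM⟩ := exists_bound h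
  have hM0 : 0 ≤ M := (abs_nonneg _).trans (hM t ht)
  have hb : BddAbove (range fun t => ⨆ (_ : t ∈ Icc (0:ℝ) 1), |ρ t|) := by
    refine ⟨M, ?_⟩
    rintro _ ⟨x, rfl⟩
    exact Real.iSup_le (fun hx => hM x hx) hM0
  refine le_trans ?_ (le_ciSup hb t)
  simp only [ht, ciSup_unique, le_refl]

lemma main_pos (χ : ℝ) (h0 : 0 < χ) (h1 : χ < 1) (ρ : ℝ → ℝ) (M : ℝ)
    (h2 : ContinuousOn ρ (Icc 0 1)) (hM : ∀ t ∈ Icc (0:ℝ) 1, |ρ t| ≤ M) (g : ℝ → ℝ)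
    (hg : ∀ s ∈ Ioc (0:ℝ) 1, g s = ∫ t in (0:ℝ)..1, Lker χ t s * ρ t)
    (hg0 : g 0 = -(χ * Real.pi) * ρ 0) :
    ContinuousOn g (Icc 0 1) ∧ ∀ s ∈ Icc (0:ℝ) 1, |g s| ≤ χ * Real.pi * M := by
  have ha0 : 0 < χ * Real.pi := mul_pos h0 Real.pi_pos
  have ha1 : χ * Real.pi < Real.pi := by nlinarith [Real.pi_pos]
  have key : ∀ s ∈ Icc (0:ℝ) 1, g s = - G (χ * Real.pi) ρ s := by
    intro s hs
    rcases hs.1.eq_or_lt with h | h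
    · rw [← h, hg0, G_zero ha0 ha1]; ring
    · rw [hg s ⟨h, hs.2⟩, G_pos χ ρ h]
  refine ⟨(G_cont ha0 ha1 h2).neg.congr key, fun s hs => ?_⟩
  rw [key s hs, abs_neg]
  exact G_bound ha0 ha1 hM s

end WedgeAux

theorem wedge_component_continuous_and_bounded (χ : ℝ) (hχ : χ ∈ Set.Ioo (-1 : ℝ) 1)
    (hχ0 : χ ≠ 0) (ρ₁ ρ₂ : ℝ → ℝ)
    (h1 : ContinuousOn ρ₁ (Set.Icc 0 1)) (h2 : ContinuousOn ρ₂ (Set.Icc 0 1))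
    (h0 : ρ₁ 0 = ρ₂ 0) (g : ℝ → ℝ)
    (hg : ∀ s ∈ Set.Ioc (0:ℝ) 1, g s = ∫ t in (0:ℝ)..1, Lker χ t s * ρ₂ t)
    (hg0 : g 0 = -(χ * Real.pi) * ρ₁ 0) :
    ContinuousOn g (Set.Icc 0 1) ∧
      ∀ s ∈ Set.Icc (0:ℝ) 1,
        |g s| ≤ |χ| * Real.pi *
          max (⨆ t ∈ Set.Icc (0:ℝ) 1, |ρ₁ t|) (⨆ t ∈ Set.Icc (0:ℝ) 1, |ρ₂ t|) := by
  have hM : ∀ t ∈ Set.Icc (0:ℝ) 1, |ρ₂ t| ≤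
      max (⨆ t ∈ Set.Icc (0:ℝ) 1, |ρ₁ t|) (⨆ t ∈ Set.Icc (0:ℝ) 1, |ρ₂ t|) :=
    fun t ht => (WedgeAux.le_biSup h2 ht).trans (le_max_right _ _)
  rw [h0] at hg0
  rcases lt_or_gt_of_ne hχ0 with hn | hp
  · have := WedgeAux.main_pos (-χ) (by linarith) (by linarith [hχ.1]) ρ₂ _ h2 hM (fun s => - g s)
      (fun s hs => by
        simp only [WedgeAux.Lker_neg, neg_mul, intervalIntegral.integral_neg]
        rw [hg s hs])
      (by rw [hg0]; ring)
    rw [abs_of_neg hn]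
    refine ⟨this.1.neg.congr fun x _ => (neg_neg (g x)).symm, fun s hs => ?_⟩
    simpa only [abs_neg] using this.2 s hs
  · rw [abs_of_pos hp]
    exact WedgeAux.main_pos χ hp hχ.2 ρ₂ _ h2 hM g hg hg0
end
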